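/- There exist absolute constants c, C₁, C₂ > 0 such that the following holds. Let ψ : [0,∞) → ℝ be convex and twice continuously differentiable on (0,∞), ε' > 0, ψ_ε(t) = ψ(t) + ε' t log t, G > 0, and let each ℓ_i : 𝒳 → ℝ be convex, G-Lipschitz and L-smooth (differentiable with L-Lipschitz gradient). Let x̄ ∈ 𝒳, let ȳ minimize y ↦ Υ_ε(x̄, y), set p̄_i = q(ℓ_i(x̄) − G ȳ), r_ε = ε'/G, and let 0 ≤ λ ≤ c G/r_ε. Define υ_i(x,y) = ψ_ε*(ℓ_i(x) − G y)/p̄_i + G y + (λ/2)‖x − x̄‖². Then, on the domain {(x,y) : x ∈ B_{r_ε}(x̄) ∩ 𝒳, y ∈ [ȳ − r_ε, ȳ + r_ε]}, each υ_i is C₁ G-Lipschitz and its gradient is C₂ (L + G²/ε')-Lipschitz. -/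

import Mathlib

noncomputable section

/-- Entropy-regularized divergence function `ψ_ε(t) = ψ(t) + ε' t log t`. -/
def psiEps (ψ : ℝ → ℝ) (ε' t : ℝ) : ℝ := ψ t + ε' * t * Real.log t

/-- The Fenchel conjugate of `ψ_ε`: `ψ_ε*(v) = sup_{t ≥ 0} (vt − ψ_ε(t))` (finite on `ℝ`). -/
def psiEpsStar (ψ : ℝ → ℝ) (ε' v : ℝ) : ℝ :=
  sSup {u : ℝ | ∃ t, 0 ≤ t ∧ u = v * t - psiEps ψ ε' t}

/-- The dual objective `Υ_ε(x, ·)` with `c_i = ℓ_i(x)`: `Υ(y) = Σ_i ψ_ε*(c_i − G y) + G y`. -/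
def UpsilonDual {N : ℕ} (ψ : ℝ → ℝ) (ε' G : ℝ) (c : Fin N → ℝ) (y : ℝ) : ℝ :=
  (∑ i, psiEpsStar ψ ε' (c i - G * y)) + G * y


theorem aux_star (ψ : ℝ → ℝ) (ε' v q : ℝ) (hq : 0 ≤ q)
    (h : IsMaxOn (fun t => v * t - psiEps ψ ε' t) (Set.Ici 0) q) :
    psiEpsStar ψ ε' v = v * q - psiEps ψ ε' q := by
  unfold psiEpsStar
  apply IsGreatest.csSup_eq
  refine ⟨⟨q, hq, rfl⟩, ?_⟩
  rintro u ⟨t, ht, rfl⟩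
  exact h (show t ∈ Set.Ici (0:ℝ) from ht)

theorem aux_pos (ψ : ℝ → ℝ) (ε' : ℝ) (hε : 0 < ε') (hψ : ConvexOn ℝ (Set.Ici 0) ψ)
    (v q : ℝ) (hq : 0 ≤ q)
    (h : IsMaxOn (fun t => v * t - psiEps ψ ε' t) (Set.Ici 0) q) : 0 < q := by
  rcases hq.lt_or_eq with h1 | h1
  · exact h1
  exfalso
  subst h1
  set K : ℝ := (|v - (ψ 1 - ψ 0)| + 1) / ε' with hK
  have hKpos : 0 < K := by positivity
  set t := Real.exp (-K) with ht
  have ht0 : 0 < t := Real.exp_pos _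
  have ht1 : t ≤ 1 := Real.exp_le_one_iff.mpr (by linarith)
  have hc := hψ.2 (show (0:ℝ) ∈ Set.Ici (0:ℝ) by simp) (show (1:ℝ) ∈ Set.Ici (0:ℝ) by simp)
    (show 0 ≤ 1 - t by linarith) ht0.le (by ring)
  simp only [smul_eq_mul, mul_zero, mul_one, zero_add] at hc
  have hm := h (show t ∈ Set.Ici (0:ℝ) from ht0.le)
  simp only [psiEps, Set.mem_ofPred_eq, mul_zero, Real.log_zero, add_zero, zero_sub] at hm
  have hlog : Real.log t = -K := Real.log_exp _
  rw [hlog] at hm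
  have hKe : ε' * K = |v - (ψ 1 - ψ 0)| + 1 := by rw [hK]; field_simp
  have habs := neg_abs_le (v - (ψ 1 - ψ 0))
  have : 0 < t * (v - (ψ 1 - ψ 0) + ε' * K) := mul_pos ht0 (by rw [hKe]; linarith)
  nlinarith

theorem aux_foc (ψ : ℝ → ℝ) (ε' : ℝ) (hd : ContDiffOn ℝ 2 ψ (Set.Ioi 0))
    (v q : ℝ) (hq : 0 < q)
    (h : IsMaxOn (fun t => v * t - psiEps ψ ε' t) (Set.Ici 0) q) :
    v = deriv ψ q + ε' * (Real.log q + 1) := by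
  have hψd : DifferentiableAt ℝ ψ q :=
    (hd.differentiableOn (by norm_num)).differentiableAt (Ioi_mem_nhds hq)
  have h1 : HasDerivAt (fun t => v * t - (ψ t + ε' * (t * Real.log t)))
      (v * 1 - (deriv ψ q + ε' * (Real.log q + 1))) q :=
    ((hasDerivAt_id q).const_mul v).sub
      (hψd.hasDerivAt.add ((Real.hasDerivAt_mul_log hq.ne').const_mul ε'))
  have hmax : IsLocalMax (fun t => v * t - (ψ t + ε' * (t * Real.log t))) q := by
    have := h.isLocalMax (Ici_mem_nhds hq)
    simpa only [psiEps, mul_assoc] using this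
  have := hmax.hasDerivAt_eq_zero h1
  linarith

/-- `Q` is monotone and `log Q` is `1/ε'`-Lipschitz. -/
theorem aux_Q (ψ : ℝ → ℝ) (ε' : ℝ) (hε : 0 < ε') (hψ : ConvexOn ℝ (Set.Ici 0) ψ)
    (hd : ContDiffOn ℝ 2 ψ (Set.Ioi 0)) (Q : ℝ → ℝ)
    (hQ : ∀ v, 0 ≤ Q v ∧ IsMaxOn (fun t => v * t - psiEps ψ ε' t) (Set.Ici 0) (Q v))
    (u v : ℝ) (huv : u ≤ v) :
    Q u ≤ Q v ∧ ε' * (Real.log (Q v) - Real.log (Q u)) ≤ v - u := by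
  have pu := aux_pos ψ ε' hε hψ u _ (hQ u).1 (hQ u).2
  have pv := aux_pos ψ ε' hε hψ v _ (hQ v).1 (hQ v).2
  have fu := aux_foc ψ ε' hd u _ pu (hQ u).2
  have fv := aux_foc ψ ε' hd v _ pv (hQ v).2
  have hm : MonotoneOn (deriv ψ) (Set.Ioi 0) :=
    (hψ.subset Set.Ioi_subset_Ici_self (convex_Ioi 0)).monotoneOn_deriv
      (fun x hx => (hd.differentiableOn (by norm_num)).differentiableAt (Ioi_mem_nhds hx))
  have hle : Q u ≤ Q v := by
    by_contra! hlt
    have h1 := hm pv pu hlt.le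
    have h2 := Real.log_lt_log pv hlt
    have h3 := mul_lt_mul_of_pos_left h2 hε
    nlinarith
  exact ⟨hle, by have h1 := hm pu pv hle; nlinarith⟩

theorem aux_exp (ψ : ℝ → ℝ) (ε' : ℝ) (hε : 0 < ε') (hψ : ConvexOn ℝ (Set.Ici 0) ψ)
    (hd : ContDiffOn ℝ 2 ψ (Set.Ioi 0)) (Q : ℝ → ℝ)
    (hQ : ∀ v, 0 ≤ Q v ∧ IsMaxOn (fun t => v * t - psiEps ψ ε' t) (Set.Ici 0) (Q v))
    (u v : ℝ) : Q v ≤ Real.exp (|v - u| / ε') * Q u := by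
  have pu := aux_pos ψ ε' hε hψ u _ (hQ u).1 (hQ u).2
  have pv := aux_pos ψ ε' hε hψ v _ (hQ v).1 (hQ v).2
  rcases le_total u v with h | h
  · have h1 := (aux_Q ψ ε' hε hψ hd Q hQ u v h).2
    have h2 : Real.log (Q v) ≤ |v - u| / ε' + Real.log (Q u) := by
      rw [abs_of_nonneg (by linarith), ← sub_le_iff_le_add, le_div_iff₀ hε]
      linarith
    calc Q v = Real.exp (Real.log (Q v)) := (Real.exp_log pv).symm
      _ ≤ Real.exp (|v - u| / ε' + Real.log (Q u)) := Real.exp_le_exp.mpr h2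
      _ = _ := by rw [Real.exp_add, Real.exp_log pu]
  · have h1 := (aux_Q ψ ε' hε hψ hd Q hQ v u h).1
    have h2 : 1 ≤ Real.exp (|v - u| / ε') := Real.one_le_exp (by positivity)
    nlinarith

theorem aux_Qlip (ψ : ℝ → ℝ) (ε' : ℝ) (hε : 0 < ε') (hψ : ConvexOn ℝ (Set.Ici 0) ψ)
    (hd : ContDiffOn ℝ 2 ψ (Set.Ioi 0)) (Q : ℝ → ℝ)
    (hQ : ∀ v, 0 ≤ Q v ∧ IsMaxOn (fun t => v * t - psiEps ψ ε' t) (Set.Ici 0) (Q v))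
    (u v M : ℝ) (hu : Q u ≤ M) (hv : Q v ≤ M) : |Q v - Q u| ≤ M * |v - u| / ε' := by
  wlog h : u ≤ v generalizing u v
  · rw [abs_sub_comm, abs_sub_comm v u]
    exact this v u hv hu (le_of_not_ge h)
  have pu := aux_pos ψ ε' hε hψ u _ (hQ u).1 (hQ u).2
  have pv := aux_pos ψ ε' hε hψ v _ (hQ v).1 (hQ v).2
  obtain ⟨h1, h2⟩ := aux_Q ψ ε' hε hψ hd Q hQ u v h
  rw [abs_of_nonneg (by linarith), abs_of_nonneg (by linarith), le_div_iff₀ hε]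
  have h3 : Real.log (Q u / Q v) ≤ Q u / Q v - 1 := Real.log_le_sub_one_of_pos (by positivity)
  rw [Real.log_div pu.ne' pv.ne'] at h3
  have h4 : Q v - Q u ≤ Q v * (Real.log (Q v) - Real.log (Q u)) := by
    have h5 := mul_le_mul_of_nonneg_left h3 pv.le
    have h6 : Q v * (Q u / Q v - 1) = Q u - Q v := by field_simp
    rw [h6] at h5
    linarith
  calc (Q v - Q u) * ε' ≤ Q v * (Real.log (Q v) - Real.log (Q u)) * ε' := by gcongr
    _ = Q v * (ε' * (Real.log (Q v) - Real.log (Q u))) := by ring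
    _ ≤ Q v * (v - u) := by gcongr
    _ ≤ M * (v - u) := mul_le_mul_of_nonneg_right hv (by linarith)

theorem aux_sub (ψ : ℝ → ℝ) (ε' : ℝ) (Q : ℝ → ℝ)
    (hQ : ∀ v, 0 ≤ Q v ∧ IsMaxOn (fun t => v * t - psiEps ψ ε' t) (Set.Ici 0) (Q v))
    (u v : ℝ) : (u - v) * Q v ≤ psiEpsStar ψ ε' u - psiEpsStar ψ ε' v := by
  rw [aux_star ψ ε' u _ (hQ u).1 (hQ u).2, aux_star ψ ε' v _ (hQ v).1 (hQ v).2]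
  have := (hQ u).2 (show Q v ∈ Set.Ici (0:ℝ) from (hQ v).1)
  simp only [Set.mem_ofPred_eq] at this
  linarith

theorem aux_starlip (ψ : ℝ → ℝ) (ε' : ℝ) (Q : ℝ → ℝ)
    (hQ : ∀ v, 0 ≤ Q v ∧ IsMaxOn (fun t => v * t - psiEps ψ ε' t) (Set.Ici 0) (Q v))
    (u v M : ℝ) (hu : Q u ≤ M) (hv : Q v ≤ M) :
    |psiEpsStar ψ ε' u - psiEpsStar ψ ε' v| ≤ M * |u - v| := by
  have h1 := aux_sub ψ ε' Q hQ u v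
  have h2 := aux_sub ψ ε' Q hQ v u
  have := (hQ u).1
  have := (hQ v).1
  have h3 := neg_abs_le (u - v)
  have h4 := le_abs_self (u - v)
  have h5 := abs_nonneg (u - v)
  rw [abs_le]
  constructor <;> nlinarith

theorem aux_deriv (ψ : ℝ → ℝ) (ε' : ℝ) (hε : 0 < ε') (hψ : ConvexOn ℝ (Set.Ici 0) ψ)
    (hd : ContDiffOn ℝ 2 ψ (Set.Ioi 0)) (Q : ℝ → ℝ)
    (hQ : ∀ v, 0 ≤ Q v ∧ IsMaxOn (fun t => v * t - psiEps ψ ε' t) (Set.Ici 0) (Q v))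
    (v : ℝ) : HasDerivAt (psiEpsStar ψ ε') (Q v) v := by
  rw [hasDerivAt_iff_isLittleO]
  have hmono : ∀ a b, a ≤ b → Q a ≤ Q b := fun a b h => (aux_Q ψ ε' hε hψ hd Q hQ a b h).1
  have hpos : ∀ a, 0 < Q a := fun a => aux_pos ψ ε' hε hψ a _ (hQ a).1 (hQ a).2
  set K := Q (v + 1) / ε' with hK
  have hKp : 0 < K := div_pos (hpos _) hε
  rw [Asymptotics.isLittleO_iff]
  intro c hc
  have hδ : 0 < min 1 (c / K) := by positivity
  filter_upwards [Metric.ball_mem_nhds v hδ] with x hx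
  rw [Metric.mem_ball, Real.dist_eq] at hx
  have hx1 := hx.trans_le (min_le_left _ _)
  have hx2 := hx.trans_le (min_le_right _ _)
  have hb := aux_Qlip ψ ε' hε hψ hd Q hQ v x (Q (v+1))
    (hmono _ _ (by linarith)) (hmono _ _ (by linarith [(abs_lt.mp hx1).2]))
  have hb2 : |Q x - Q v| ≤ c := by
    rw [lt_div_iff₀ hKp] at hx2
    have : Q (v+1) * |x - v| / ε' = |x - v| * K := by rw [hK]; ring
    linarith
  have h1 := aux_sub ψ ε' Q hQ x v
  have h2 := aux_sub ψ ε' Q hQ v x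
  rw [smul_eq_mul, Real.norm_eq_abs, Real.norm_eq_abs, abs_of_nonneg (by linarith)]
  calc psiEpsStar ψ ε' x - psiEpsStar ψ ε' v - (x - v) * Q v
      ≤ (Q x - Q v) * (x - v) := by linarith
    _ ≤ |(Q x - Q v) * (x - v)| := le_abs_self _
    _ = |Q x - Q v| * |x - v| := abs_mul _ _
    _ ≤ c * |x - v| := by gcongr

/-- There exist absolute constants `c, C₁, C₂ > 0` such that for convex,
`C²`-on-`(0,∞)` `ψ`, convex `G`-Lipschitz `L`-smooth losses, `p̄_i = q(ℓ_i(x̄) − G ȳ)`,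
`r_ε = ε'/G`, `0 ≤ λ ≤ c G/r_ε`, each
`υ_i(x,y) = ψ_ε*(ℓ_i(x) − G y)/p̄_i + G y + (λ/2)‖x − x̄‖²`, restricted to
`(B_{r_ε}(x̄) ∩ 𝒳) × [ȳ − r_ε, ȳ + r_ε]`, is `C₁ G`-Lipschitz and has
`C₂ (L + G²/ε')`-Lipschitz gradient. -/
theorem stmt14 :
    ∃ c C₁ C₂ : ℝ, 0 < c ∧ 0 < C₁ ∧ 0 < C₂ ∧
    ∀ (d N : ℕ) (_ : 1 ≤ N)
      (𝒳 : Set (EuclideanSpace ℝ (Fin d))) (_ : Convex ℝ 𝒳) (_ : IsClosed 𝒳)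
      (ψ : ℝ → ℝ) (_ : ConvexOn ℝ (Set.Ici 0) ψ) (_ : ContDiffOn ℝ 2 ψ (Set.Ioi 0))
      (ε' : ℝ) (_ : 0 < ε') (G L : ℝ) (_ : 0 < G) (_ : 0 ≤ L)
      (Q : ℝ → ℝ)
      (_ : ∀ v, 0 ≤ Q v ∧ IsMaxOn (fun t => v * t - psiEps ψ ε' t) (Set.Ici 0) (Q v))
      (ℓ : Fin N → EuclideanSpace ℝ (Fin d) → ℝ)
      (gradℓ : Fin N → EuclideanSpace ℝ (Fin d) → EuclideanSpace ℝ (Fin d))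
      (_ : ∀ i, ConvexOn ℝ Set.univ (ℓ i))
      (_ : ∀ i z, HasGradientAt (ℓ i) (gradℓ i z) z)
      (_ : ∀ i (z z' : EuclideanSpace ℝ (Fin d)), |ℓ i z - ℓ i z'| ≤ G * ‖z - z'‖)
      (_ : ∀ i (z z' : EuclideanSpace ℝ (Fin d)), ‖gradℓ i z - gradℓ i z'‖ ≤ L * ‖z - z'‖)
      (xbar : EuclideanSpace ℝ (Fin d)) (_ : xbar ∈ 𝒳)
      (ybar : ℝ) (_ : IsMinOn (UpsilonDual ψ ε' G (fun i => ℓ i xbar)) Set.univ ybar)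
      (rε lam : ℝ) (_ : rε = ε' / G) (_ : 0 ≤ lam) (_ : lam ≤ c * G / rε)
      (i : Fin N),
      let υ : EuclideanSpace ℝ (Fin d) × ℝ → ℝ := fun p =>
        psiEpsStar ψ ε' (ℓ i p.1 - G * p.2) / Q (ℓ i xbar - G * ybar) + G * p.2 +
          lam / 2 * ‖p.1 - xbar‖ ^ 2
      let D : Set (EuclideanSpace ℝ (Fin d) × ℝ) :=
        (Metric.closedBall xbar rε ∩ 𝒳) ×ˢ Set.Icc (ybar - rε) (ybar + rε)
      Differentiable ℝ υ ∧
      (∀ p ∈ D, ∀ q ∈ D, |υ p - υ q| ≤ C₁ * G * ‖p - q‖) ∧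
      (∀ p ∈ D, ∀ q ∈ D,
        ‖fderiv ℝ υ p - fderiv ℝ υ q‖ ≤ C₂ * (L + G ^ 2 / ε') * ‖p - q‖) := by
  refine ⟨1, 2 * Real.exp 2 + 2, 4 * Real.exp 2 + 1, one_pos, by positivity, by positivity, ?_⟩
  intro d N _ 𝒳 _ _ ψ hψ hd ε' hε G L hG hL Q hQ ℓ gradℓ _ hgrad hlip hsm xbar _ ybar _
    rε lam hr hlam0 hlam i υ D
  have hpos : ∀ a, 0 < Q a := fun a => aux_pos ψ ε' hε hψ a _ (hQ a).1 (hQ a).2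
  have hr0 : 0 < rε := by rw [hr]; positivity
  have hGr : G * rε = ε' := by rw [hr]; field_simp
  have hlr : lam * rε ≤ G := by
    rw [le_div_iff₀ hr0] at hlam; linarith
  have hlamG : lam ≤ G ^ 2 / ε' := by
    rw [le_div_iff₀ hε, ← hGr]; nlinarith
  set vb := ℓ i xbar - G * ybar with hvb
  let V : EuclideanSpace ℝ (Fin d) × ℝ → ℝ := fun p => ℓ i p.1 - G * p.2
  let g : EuclideanSpace ℝ (Fin d) → (EuclideanSpace ℝ (Fin d) →L[ℝ] ℝ) := fun z =>
    InnerProductSpace.toDual ℝ _ (gradℓ i z)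
  have hg : ∀ z, HasFDerivAt (ℓ i) (g z) z := fun z => (hgrad i z).hasFDerivAt
  have hgn : ∀ z, ‖g z‖ ≤ G := fun z =>
    (hg z).le_of_lip' hG.le (Filter.Eventually.of_forall fun x => by
      rw [Real.norm_eq_abs]; exact hlip i x z)
  have hgl : ∀ z z', ‖g z - g z'‖ ≤ L * ‖z - z'‖ := fun z z' => by
    have : g z - g z' = InnerProductSpace.toDual ℝ _ (gradℓ i z - gradℓ i z') := by
      simp only [g, map_sub]
    rw [this, LinearIsometryEquiv.norm_map]
    exact hsm i z z'
  let F := ContinuousLinearMap.fst ℝ (EuclideanSpace ℝ (Fin d)) ℝ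
  let S := ContinuousLinearMap.snd ℝ (EuclideanSpace ℝ (Fin d)) ℝ
  have hFn : ‖F‖ ≤ 1 := ContinuousLinearMap.norm_fst_le _ _ _
  have hSn : ‖S‖ ≤ 1 := ContinuousLinearMap.norm_snd_le _ _ _
  let A : EuclideanSpace ℝ (Fin d) × ℝ → (EuclideanSpace ℝ (Fin d) × ℝ →L[ℝ] ℝ) := fun p =>
    (g p.1).comp F - G • S
  have hcF : ∀ T : EuclideanSpace ℝ (Fin d) →L[ℝ] ℝ, ‖T.comp F‖ ≤ ‖T‖ := fun T =>
    (T.opNorm_comp_le F).trans (by nlinarith [norm_nonneg T])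
  have hAn : ∀ p, ‖A p‖ ≤ 2 * G := fun p => by
    have h1 := norm_sub_le ((g p.1).comp F) (G • S)
    have h2 := hcF (g p.1)
    have h3 : ‖G • S‖ ≤ G := by
      rw [norm_smul, Real.norm_eq_abs, abs_of_pos hG]; nlinarith
    have h4 := hgn p.1
    show ‖(g p.1).comp F - G • S‖ ≤ 2 * G
    linarith
  have hp1 : ∀ p q : EuclideanSpace ℝ (Fin d) × ℝ, ‖p.1 - q.1‖ ≤ ‖p - q‖ := fun p q =>
    norm_fst_le (p - q)
  have hp2 : ∀ p q : EuclideanSpace ℝ (Fin d) × ℝ, |p.2 - q.2| ≤ ‖p - q‖ := fun p q =>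
    norm_snd_le (p - q)
  have hAl : ∀ p q, ‖A p - A q‖ ≤ L * ‖p - q‖ := fun p q => by
    have : A p - A q = (g p.1 - g q.1).comp F := by
      simp only [A, ContinuousLinearMap.sub_comp]; abel
    rw [this]
    exact (hcF _).trans ((hgl _ _).trans (mul_le_mul_of_nonneg_left (hp1 p q) hL))
  have hV : ∀ p, HasFDerivAt V (A p) p := fun p => by
    have h1 : HasFDerivAt (fun p : EuclideanSpace ℝ (Fin d) × ℝ => ℓ i p.1) ((g p.1).comp F) p :=
      (hg p.1).comp p hasFDerivAt_fst
    exact h1.sub (hasFDerivAt_snd.const_mul G)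
  let I : EuclideanSpace ℝ (Fin d) × ℝ → (EuclideanSpace ℝ (Fin d) × ℝ →L[ℝ] ℝ) := fun p =>
    (innerSL ℝ (p.1 - xbar)).comp F
  have hυ : ∀ p, HasFDerivAt υ ((Q (V p) / Q vb) • A p + G • S + lam • I p) p := fun p => by
    have h1 : HasFDerivAt (fun p => psiEpsStar ψ ε' (V p)) (Q (V p) • A p) p :=
      (aux_deriv ψ ε' hε hψ hd Q hQ (V p)).comp_hasFDerivAt p (hV p)
    have h2 : HasFDerivAt (fun p : EuclideanSpace ℝ (Fin d) × ℝ => p.1 - xbar) F p :=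
      hasFDerivAt_fst.sub_const xbar
    have h3 := (h2.norm_sq).const_mul (lam / 2)
    have h4 := ((h1.mul_const (Q vb)⁻¹).add (hasFDerivAt_snd.const_mul G)).add h3
    have e1 : υ = fun p => psiEpsStar ψ ε' (V p) * (Q vb)⁻¹ + G * p.2 +
        lam / 2 * ‖p.1 - xbar‖ ^ 2 := by
      funext p; simp only [υ, V, hvb, div_eq_mul_inv]
    rw [e1]
    refine h4.congr_fderiv ?_
    ext z <;> simp [I, F, S] <;> ring
  have hVl : ∀ p q, |V p - V q| ≤ 2 * G * ‖p - q‖ := fun p q => by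
    have e : V p - V q = (ℓ i p.1 - ℓ i q.1) - G * (p.2 - q.2) := by simp only [V]; ring
    rw [e]
    have h1 := abs_sub (ℓ i p.1 - ℓ i q.1) (G * (p.2 - q.2))
    rw [abs_mul, abs_of_pos hG] at h1
    have h2 := hlip i p.1 q.1
    have h3 := mul_le_mul_of_nonneg_left (hp1 p q) hG.le
    have h4 := mul_le_mul_of_nonneg_left (hp2 p q) hG.le
    linarith
  have hDn : ∀ p ∈ D, ‖p.1 - xbar‖ ≤ rε := fun p hp => by
    have := hp.1.1
    rwa [Metric.mem_closedBall, dist_eq_norm] at this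
  have hDQ : ∀ p ∈ D, Q (V p) ≤ Real.exp 2 * Q vb := fun p hp => by
    have h1 := aux_exp ψ ε' hε hψ hd Q hQ vb (V p)
    have h2 : |V p - vb| ≤ 2 * G * rε := by
      refine (hVl p (xbar, ybar)).trans ?_
      gcongr
      refine (Prod.norm_def _).le.trans (max_le (hDn p hp) ?_)
      have := hp.2
      rw [Set.mem_Icc] at this
      show |p.2 - ybar| ≤ rε
      rw [abs_le]; constructor <;> linarith
    refine h1.trans ?_
    have h3 : |V p - vb| / ε' ≤ 2 := by
      rw [div_le_iff₀ hε]; linarith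
    exact mul_le_mul_of_nonneg_right (Real.exp_le_exp.mpr h3) (hpos _).le
  have hE := Real.exp_pos 2
  refine ⟨fun p => (hυ p).differentiableAt, ?_, ?_⟩
  · intro p hp q hq
    have e : υ p - υ q = (psiEpsStar ψ ε' (V p) - psiEpsStar ψ ε' (V q)) / Q vb
        + G * (p.2 - q.2) + lam / 2 * (‖p.1 - xbar‖ ^ 2 - ‖q.1 - xbar‖ ^ 2) := by
      simp only [υ, V]; ring
    have b1 : |(psiEpsStar ψ ε' (V p) - psiEpsStar ψ ε' (V q)) / Q vb|
        ≤ Real.exp 2 * (2 * G * ‖p - q‖) := by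
      rw [abs_div, abs_of_pos (hpos vb), div_le_iff₀ (hpos vb)]
      have h1 := aux_starlip ψ ε' Q hQ (V p) (V q) _ (hDQ p hp) (hDQ q hq)
      refine h1.trans ?_
      have h2 := mul_le_mul_of_nonneg_left (hVl p q) (mul_pos hE (hpos vb)).le
      linarith
    have b2 : |G * (p.2 - q.2)| ≤ G * ‖p - q‖ := by
      rw [abs_mul, abs_of_pos hG]
      exact mul_le_mul_of_nonneg_left (hp2 p q) hG.le
    have b3 : |lam / 2 * (‖p.1 - xbar‖ ^ 2 - ‖q.1 - xbar‖ ^ 2)| ≤ G * ‖p - q‖ := by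
      have h1 : |‖p.1 - xbar‖ - ‖q.1 - xbar‖| ≤ ‖p - q‖ := by
        refine (abs_norm_sub_norm_le _ _).trans ?_
        rw [sub_sub_sub_cancel_right]; exact hp1 p q
      have h2 : |‖p.1 - xbar‖ + ‖q.1 - xbar‖| ≤ 2 * rε := by
        rw [abs_of_nonneg (by positivity)]
        linarith [hDn p hp, hDn q hq]
      rw [sq_sub_sq, abs_mul, abs_mul, abs_of_nonneg (by positivity : 0 ≤ lam / 2)]
      calc lam / 2 * (|‖p.1 - xbar‖ + ‖q.1 - xbar‖| * |‖p.1 - xbar‖ - ‖q.1 - xbar‖|)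
          ≤ lam / 2 * ((2 * rε) * ‖p - q‖) := by gcongr
        _ = lam * rε * ‖p - q‖ := by ring
        _ ≤ G * ‖p - q‖ := by gcongr
    rw [e]
    have t1 := abs_add_three ((psiEpsStar ψ ε' (V p) - psiEpsStar ψ ε' (V q)) / Q vb)
      (G * (p.2 - q.2)) (lam / 2 * (‖p.1 - xbar‖ ^ 2 - ‖q.1 - xbar‖ ^ 2))
    linarith
  · intro p hp q hq
    rw [(hυ p).fderiv, (hυ q).fderiv]
    have e : ((Q (V p) / Q vb) • A p + G • S + lam • I p) -
        ((Q (V q) / Q vb) • A q + G • S + lam • I q) =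
        ((Q (V p) - Q (V q)) / Q vb) • A p + (Q (V q) / Q vb) • (A p - A q)
          + lam • (I p - I q) := by
      rw [sub_div]; module
    rw [e]
    have b1 : ‖((Q (V p) - Q (V q)) / Q vb) • A p‖
        ≤ 4 * Real.exp 2 * (G ^ 2 / ε') * ‖p - q‖ := by
      rw [norm_smul, Real.norm_eq_abs]
      have h1 : |(Q (V p) - Q (V q)) / Q vb| ≤ Real.exp 2 * (2 * G * ‖p - q‖) / ε' := by
        rw [abs_div, abs_of_pos (hpos vb), div_le_iff₀ (hpos vb)]
        refine (aux_Qlip ψ ε' hε hψ hd Q hQ (V q) (V p) _ (hDQ q hq) (hDQ p hp)).trans ?_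
        rw [div_mul_eq_mul_div]
        apply div_le_div_of_nonneg_right _ hε.le
        have h2 := mul_le_mul_of_nonneg_left (hVl p q) (mul_pos hE (hpos vb)).le
        linarith
      calc _ ≤ Real.exp 2 * (2 * G * ‖p - q‖) / ε' * (2 * G) := by
            gcongr
            exact hAn p
        _ = _ := by ring
    have b2 : ‖(Q (V q) / Q vb) • (A p - A q)‖ ≤ Real.exp 2 * (L * ‖p - q‖) := by
      rw [norm_smul, Real.norm_eq_abs, abs_of_pos (div_pos (hpos _) (hpos _))]
      have h1 : Q (V q) / Q vb ≤ Real.exp 2 := by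
        rw [div_le_iff₀ (hpos vb)]; exact hDQ q hq
      exact mul_le_mul h1 (hAl p q) (norm_nonneg _) hE.le
    have b3 : ‖lam • (I p - I q)‖ ≤ G ^ 2 / ε' * ‖p - q‖ := by
      rw [norm_smul, Real.norm_eq_abs, abs_of_nonneg hlam0]
      have h1 : I p - I q = (innerSL ℝ (p.1 - q.1)).comp F := by
        simp only [I]
        rw [← ContinuousLinearMap.sub_comp, ← map_sub, sub_sub_sub_cancel_right]
      have h2 : ‖I p - I q‖ ≤ ‖p - q‖ := by
        rw [h1]
        refine (hcF _).trans ?_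
        rw [innerSL_apply_norm]
        exact hp1 p q
      exact mul_le_mul hlamG h2 (norm_nonneg _) (by positivity)
    have t1 := norm_add₃_le (a := ((Q (V p) - Q (V q)) / Q vb) • A p)
      (b := (Q (V q) / Q vb) • (A p - A q)) (c := lam • (I p - I q))
    have h0 : 0 ≤ L * ‖p - q‖ := by positivity
    have h00 : 0 ≤ Real.exp 2 * (L * ‖p - q‖) := by positivity
    linarith
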